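/- arXiv:2603.17691 — 8 statements merged into one kernel-verified Lean document; each statement's English description precedes it below -/
import Mathlib

section
/- Let X ⊆ ℝ^n, let F_lb, F_ub : ℝ^n → ℝ^k satisfy F_lb(x) ≤ F_ub(x) componentwise for all x ∈ X, let K = ℝ^k_+, and define the hyperbox-valued mapping S(x) = [F_lb(x), F_ub(x)]. Then x̄ ∈ X is a strictly minimal solution of the hyperbox-valued optimization problem min_{x∈X} S(x) with respect to the set-less relation ⪯_K if and only if x̄ is a strictly efficient solution of minimizing the vector function G(x) = (F_ub(x), F_lb(x)) ∈ ℝ^{2k} with respect to the cone ℝ^{2k}_+. -/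
/-- `a ≤_K b` iff `b - a ∈ K`. -/
def leK {α : Type*} [AddCommGroup α] (K : Set α) (a b : α) : Prop := b - a ∈ K

/-- Lower set-less relation. -/
def lowerSetLess {α : Type*} [AddCommGroup α] (K A B : Set α) : Prop :=
  ∀ b ∈ B, ∃ a ∈ A, leK K a b

/-- Upper set-less relation. -/
def upperSetLess {α : Type*} [AddCommGroup α] (K A B : Set α) : Prop :=
  ∀ a ∈ A, ∃ b ∈ B, leK K a b

/-- Set-less relation: both lower and upper set-less. -/
def setLess {α : Type*} [AddCommGroup α] (K A B : Set α) : Prop :=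
  lowerSetLess K A B ∧ upperSetLess K A B

/-- The non-negative orthant `ℝ^k_+`. -/
def posOrthant (k : ℕ) : Set (Fin k → ℝ) := {y | 0 ≤ y}

/-- `x*` is a strictly minimal solution (set approach) of `min_{x ∈ X} S(x)` w.r.t. `⪯_K`:
`x* ∈ X` and every `x ∈ X` with `S(x) ⪯_K S(x*)` satisfies `S(x*) ⪯_K S(x)`. -/
def StrictlyMinimalSolution {β : Type*} {α : Type*} [AddCommGroup α]
    (X : Set β) (S : β → Set α) (K : Set α) (xstar : β) : Prop :=
  xstar ∈ X ∧ ∀ x ∈ X, setLess K (S x) (S xstar) → setLess K (S xstar) (S x)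

/-- `x*` is a strictly efficient solution of minimizing `G` over `X` w.r.t. the componentwise
order (cone `ℝ^q_+`): `x* ∈ X` and every `x ∈ X` with `G(x) ≤ G(x*)` satisfies `G(x) = G(x*)`. -/
def StrictlyEfficient {β : Type*} {γ : Type*} [PartialOrder γ]
    (X : Set β) (G : β → γ) (xstar : β) : Prop :=
  xstar ∈ X ∧ ∀ x ∈ X, G x ≤ G xstar → G x = G xstar

theorem setLess_Icc_iff_aux {k : ℕ} {a b c d : Fin k → ℝ} (hab : a ≤ b) (hcd : c ≤ d) :
    setLess (posOrthant k) (Set.Icc a b) (Set.Icc c d) ↔ a ≤ c ∧ b ≤ d := by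
  have hK : ∀ u v : Fin k → ℝ, leK (posOrthant k) u v ↔ u ≤ v := by
    intro u v
    simp only [leK, posOrthant, Set.mem_setOf_eq, sub_nonneg]
  simp only [setLess, lowerSetLess, upperSetLess, hK]
  constructor
  · rintro ⟨h1, h2⟩
    obtain ⟨p, hp, hpc⟩ := h1 c ⟨le_rfl, hcd⟩
    obtain ⟨q, hq, hbq⟩ := h2 b ⟨hab, le_rfl⟩
    exact ⟨hp.1.trans hpc, hbq.trans hq.2⟩
  · rintro ⟨h1, h2⟩
    exact ⟨fun y hy => ⟨a, ⟨le_rfl, hab⟩, h1.trans hy.1⟩,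
      fun y hy => ⟨d, ⟨hcd, le_rfl⟩, hy.2.trans h2⟩⟩

/-- Vectorization for hyperbox-valued optimization: with `S(x) = [F_lb(x), F_ub(x)]` and
`K = ℝ^k_+`, `x̄` is a strictly minimal solution of `min_{x∈X} S(x)` w.r.t. `⪯_K` iff `x̄` is
a strictly efficient solution of minimizing `G(x) = (F_ub(x), F_lb(x)) ∈ ℝ^{2k}` w.r.t. `ℝ^{2k}_+`. -/
theorem hvo_vectorization {n k : ℕ} (X : Set (Fin n → ℝ))
    (Flb Fub : (Fin n → ℝ) → (Fin k → ℝ))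
    (hle : ∀ x ∈ X, Flb x ≤ Fub x) (xbar : Fin n → ℝ) :
    StrictlyMinimalSolution X (fun x => Set.Icc (Flb x) (Fub x)) (posOrthant k) xbar ↔
    StrictlyEfficient X (fun x => (Fub x, Flb x)) xbar := by
  unfold StrictlyMinimalSolution StrictlyEfficient
  refine and_congr_right fun hx => forall₂_congr fun x hxX => ?_
  rw [setLess_Icc_iff_aux (hle x hxX) (hle xbar hx),
    setLess_Icc_iff_aux (hle xbar hx) (hle x hxX)]
  simp only [Prod.mk_le_mk, Prod.mk.injEq]
  constructor
  · rintro h ⟨h1, h2⟩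
    obtain ⟨h3, h4⟩ := h ⟨h2, h1⟩
    exact ⟨le_antisymm h1 h4, le_antisymm h2 h3⟩
  · rintro h ⟨h1, h2⟩
    obtain ⟨h3, h4⟩ := h ⟨h2, h1⟩
    exact ⟨h4.ge, h3.ge⟩
end

section
/- Let X ⊆ ℝ^n, let f_lb, f_ub : ℝ^n → ℝ satisfy f_lb(x) ≤ f_ub(x) for all x ∈ X, let K = ℝ_+, and define the interval-valued mapping S(x) = {y ∈ ℝ : f_lb(x) ≤ y ≤ f_ub(x)}. Then x̄ ∈ X is a strictly minimal solution of the interval-valued optimization problem min_{x∈X} S(x) with respect to the set-less relation ⪯_K if and only if x̄ is a strictly efficient solution of minimizing the vector function G(x) = (f_lb(x), f_ub(x)) ∈ ℝ² with respect to the cone ℝ²_+. -/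
theorem setLess_Icc_iff (a b c d : ℝ) (hab : a ≤ b) (hcd : c ≤ d) :
    setLess {y : ℝ | 0 ≤ y} (Set.Icc a b) (Set.Icc c d) ↔ a ≤ c ∧ b ≤ d := by
  simp only [setLess, lowerSetLess, upperSetLess, leK, Set.mem_setOf_eq, Set.mem_Icc, sub_nonneg]
  constructor
  · rintro ⟨h1, h2⟩
    obtain ⟨p, hp, hp'⟩ := h1 c ⟨le_rfl, hcd⟩
    obtain ⟨q, hq, hq'⟩ := h2 b ⟨hab, le_rfl⟩
    exact ⟨hp.1.trans hp', hq'.trans hq.2⟩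
  · rintro ⟨h1, h2⟩
    exact ⟨fun y hy => ⟨a, ⟨le_rfl, hab⟩, h1.trans hy.1⟩,
      fun y hy => ⟨d, ⟨hcd, le_rfl⟩, hy.2.trans h2⟩⟩

/-- Vectorization for interval-valued optimization: with `S(x) = {y : f_lb(x) ≤ y ≤ f_ub(x)} ⊆ ℝ`
and `K = ℝ_+`, `x̄` is a strictly minimal solution of `min_{x∈X} S(x)` w.r.t. `⪯_K` iff `x̄` is a
strictly efficient solution of minimizing `G(x) = (f_lb(x), f_ub(x)) ∈ ℝ²` w.r.t. `ℝ²_+`. -/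
theorem ivo_vectorization {n : ℕ} (X : Set (Fin n → ℝ))
    (flb fub : (Fin n → ℝ) → ℝ)
    (hle : ∀ x ∈ X, flb x ≤ fub x) (xbar : Fin n → ℝ) :
    StrictlyMinimalSolution X (fun x => Set.Icc (flb x) (fub x)) {y : ℝ | 0 ≤ y} xbar ↔
    StrictlyEfficient X (fun x => (flb x, fub x)) xbar := by
  unfold StrictlyMinimalSolution StrictlyEfficient
  refine and_congr_right fun hb => forall₂_congr fun x hx => ?_
  simp only [setLess_Icc_iff _ _ _ _ (hle x hx) (hle xbar hb),
    setLess_Icc_iff _ _ _ _ (hle xbar hb) (hle x hx), Prod.mk_le_mk, Prod.mk.injEq]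
  constructor
  · intro h h1
    have h2 := h h1
    exact ⟨le_antisymm h1.1 h2.1, le_antisymm h1.2 h2.2⟩
  · intro h h1
    have h2 := h h1
    exact ⟨h2.1.ge, h2.2.ge⟩
end

section
/- Let Z be an integrable real-valued random variable and let p ∈ (0,1). Then the subquantile of Z at level p satisfies S̲_p[Z] = sup_{η ∈ ℝ} { η − (1/p)·E[max(η − Z, 0)] }. -/
open MeasureTheory

/-- The cumulative distribution function `F_Z(t) = P(Z ≤ t)` of a random variable `Z`. -/
noncomputable def cdfRV {Ω : Type*} [MeasurableSpace Ω] (μ : Measure Ω) (Z : Ω → ℝ) (t : ℝ) : ℝ :=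
  (μ {ω | Z ω ≤ t}).toReal

/-- The quantile function `Q_Z(u) = inf {t : F_Z(t) ≥ u}` of a random variable `Z`. -/
noncomputable def quantileRV {Ω : Type*} [MeasurableSpace Ω] (μ : Measure Ω) (Z : Ω → ℝ)
    (u : ℝ) : ℝ :=
  sInf {t : ℝ | u ≤ cdfRV μ Z t}

lemma cdfRV_eq {Ω : Type*} [MeasurableSpace Ω] (μ : Measure Ω)
    [IsProbabilityMeasure μ] (Z : Ω → ℝ) (hZ : Measurable Z) (t : ℝ) :
    cdfRV μ Z t = ProbabilityTheory.cdf (μ.map Z) t := by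
  have : IsProbabilityMeasure (μ.map Z) := Measure.isProbabilityMeasure_map hZ.aemeasurable
  rw [ProbabilityTheory.cdf_eq_real, Measure.real, Measure.map_apply hZ measurableSet_Iic]
  rfl

lemma quantileRV_le_iff {Ω : Type*} [MeasurableSpace Ω] (μ : Measure Ω)
    [IsProbabilityMeasure μ] (Z : Ω → ℝ) (hZ : Measurable Z) (u : ℝ) (hu : u ∈ Set.Ioo (0 : ℝ) 1)
    (t : ℝ) : quantileRV μ Z u ≤ t ↔ u ≤ cdfRV μ Z t := by
  have hF : ∀ t, cdfRV μ Z t = ProbabilityTheory.cdf (μ.map Z) t := cdfRV_eq μ Z hZ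
  unfold quantileRV
  simp only [hF]
  set F := ProbabilityTheory.cdf (μ.map Z) with hFdef
  have hne : {t : ℝ | u ≤ F t}.Nonempty := by
    obtain ⟨t, ht⟩ := ((ProbabilityTheory.tendsto_cdf_atTop (μ.map Z)).eventually
      (lt_mem_nhds hu.2)).exists
    exact ⟨t, ht.le⟩
  have hbdd : BddBelow {t : ℝ | u ≤ F t} := by
    obtain ⟨t, ht⟩ := ((ProbabilityTheory.tendsto_cdf_atBot (μ.map Z)).eventually
      (gt_mem_nhds hu.1)).exists
    refine ⟨t, fun s hs => ?_⟩
    by_contra h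
    push Not at h
    have h1 : F s ≤ F t := F.mono h.le
    have h2 : u ≤ F s := hs
    have h3 : F t < u := ht
    linarith
  constructor
  · intro h
    refine le_trans ?_ (F.mono h)
    have hc := F.right_continuous (sInf {t : ℝ | u ≤ F t})
    have hc' : Filter.Tendsto F (nhdsWithin (sInf {t : ℝ | u ≤ F t}) (Set.Ioi _)) (nhds _) :=
      hc.mono_left (nhdsWithin_mono _ Set.Ioi_subset_Ici_self)
    refine ge_of_tendsto hc' ?_
    filter_upwards [self_mem_nhdsWithin] with x hx
    obtain ⟨y, hy, hyx⟩ := exists_lt_of_csInf_lt hne hx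
    exact le_trans hy (F.mono hyx.le)
  · intro h
    exact csInf_le hbdd h

lemma quantileRV_mono {Ω : Type*} [MeasurableSpace Ω] (μ : Measure Ω)
    [IsProbabilityMeasure μ] (Z : Ω → ℝ) (hZ : Measurable Z) :
    MonotoneOn (quantileRV μ Z) (Set.Ioo 0 1) := by
  intro u hu v hv huv
  rw [quantileRV_le_iff μ Z hZ u hu]
  exact huv.trans ((quantileRV_le_iff μ Z hZ v hv _).1 le_rfl)

lemma map_quantileRV {Ω : Type*} [MeasurableSpace Ω] (μ : Measure Ω)
    [IsProbabilityMeasure μ] (Z : Ω → ℝ) (hZ : Measurable Z) :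
    (volume.restrict (Set.Ioo (0:ℝ) 1)).map (quantileRV μ Z) = μ.map Z := by
  have hm : AEMeasurable (quantileRV μ Z) (volume.restrict (Set.Ioo (0:ℝ) 1)) :=
    aemeasurable_restrict_of_monotoneOn measurableSet_Ioo (quantileRV_mono μ Z hZ)
  have : IsFiniteMeasure (volume.restrict (Set.Ioo (0:ℝ) 1)) := ⟨by simp⟩
  refine Measure.ext_of_Iic _ _ fun t => ?_
  rw [Measure.map_apply_of_aemeasurable hm measurableSet_Iic,
    Measure.map_apply hZ measurableSet_Iic, Measure.restrict_apply' measurableSet_Ioo]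
  have h0 : μ (Z ⁻¹' Set.Iic t) = ENNReal.ofReal (cdfRV μ Z t) :=
    (ENNReal.ofReal_toReal (measure_ne_top μ _)).symm
  have h1 : cdfRV μ Z t ≤ 1 := ENNReal.toReal_le_of_le_ofReal zero_le_one (by simpa using prob_le_one)
  rw [h0]
  apply le_antisymm
  · calc _ ≤ volume (Set.Ioc 0 (cdfRV μ Z t)) := by
          apply measure_mono
          rintro u ⟨h, hu⟩
          exact ⟨hu.1, (quantileRV_le_iff μ Z hZ u hu t).1 h⟩
      _ = _ := by simp
  · calc _ = volume (Set.Ioo 0 (cdfRV μ Z t)) := by simp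
      _ ≤ _ := by
          apply measure_mono
          rintro u ⟨h, hu⟩
          have hu' : u ∈ Set.Ioo (0:ℝ) 1 := ⟨h, hu.trans_le h1⟩
          exact ⟨(quantileRV_le_iff μ Z hZ u hu' t).2 hu.le, hu'⟩

/-- Rockafellar–Uryasev-type characterization of the subquantile: for integrable `Z` and
`p ∈ (0,1)`, `S̲_p[Z] = (1/p) ∫_0^p Q_Z(u) du = sup_{η ∈ ℝ} { η − (1/p)·E[max(η − Z, 0)] }`. -/
theorem subquantile_characterization {Ω : Type*} [MeasurableSpace Ω] (μ : Measure Ω)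
    [IsProbabilityMeasure μ] (Z : Ω → ℝ) (hZ : Measurable Z) (hZint : Integrable Z μ)
    (p : ℝ) (hp : p ∈ Set.Ioo (0 : ℝ) 1) :
    (1 / p) * ∫ u in (0 : ℝ)..p, quantileRV μ Z u =
      ⨆ η : ℝ, (η - (1 / p) * ∫ ω, max (η - Z ω) 0 ∂μ) := by
  set Q := quantileRV μ Z with hQ
  have hmono := quantileRV_mono μ Z hZ
  have hmap := map_quantileRV μ Z hZ
  have hm : AEMeasurable Q (volume.restrict (Set.Ioo (0:ℝ) 1)) :=
    aemeasurable_restrict_of_monotoneOn measurableSet_Ioo hmono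
  have : IsFiniteMeasure (volume.restrict (Set.Ioo (0:ℝ) 1)) := ⟨by simp⟩
  have hint : IntegrableOn Q (Set.Ioo 0 1) := by
    have h1 : Integrable id (μ.map Z) :=
      (integrable_map_measure aestronglyMeasurable_id hZ.aemeasurable).2 hZint
    rw [← hmap] at h1
    exact (integrable_map_measure aestronglyMeasurable_id hm).1 h1
  have key : ∀ η : ℝ, ∫ ω, max (η - Z ω) 0 ∂μ = ∫ u in Set.Ioo (0:ℝ) 1, max (η - Q u) 0 := by
    intro η
    have hc : Continuous (fun x : ℝ => max (η - x) 0) := by fun_prop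
    rw [← integral_map (f := fun x : ℝ => max (η - x) 0) hZ.aemeasurable
      hc.aestronglyMeasurable, ← hmap, integral_map hm hc.aestronglyMeasurable]
  have hsub : Set.Ioc 0 p ⊆ Set.Ioo (0:ℝ) 1 := fun u hu => ⟨hu.1, hu.2.trans_lt hp.2⟩
  have hintp : IntegrableOn Q (Set.Ioc 0 p) := hint.mono_set hsub
  have hmaxint : ∀ η : ℝ, IntegrableOn (fun u => max (η - Q u) 0) (Set.Ioo 0 1) := fun η =>
    ((integrable_const η).sub hint).sup (integrable_const 0)
  have hlin : ∀ η : ℝ, ∫ u in Set.Ioc 0 p, (η - Q u) = p * η - ∫ u in Set.Ioc 0 p, Q u := by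
    intro η
    rw [integral_sub (integrable_const η) hintp]
    simp [hp.1.le]
  have hle : ∀ η : ℝ, p * η - ∫ u in Set.Ioc 0 p, Q u ≤ ∫ ω, max (η - Z ω) 0 ∂μ := by
    intro η
    rw [key, ← hlin]
    calc _ ≤ ∫ u in Set.Ioc 0 p, max (η - Q u) 0 :=
          integral_mono ((integrableOn_const (by simp)).sub hintp) ((hmaxint η).mono_set hsub)
            (fun u => le_max_left _ _)
      _ ≤ _ := setIntegral_mono_set (hmaxint η) (ae_of_all _ fun u => le_max_right _ _)
          (HasSubset.Subset.eventuallyLE hsub)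
  have heq : ∫ ω, max (Q p - Z ω) 0 ∂μ = p * Q p - ∫ u in Set.Ioc 0 p, Q u := by
    rw [key, ← hlin]
    have hrest : ∫ u in Set.Ioo (0:ℝ) 1, max (Q p - Q u) 0
        = ∫ u in Set.Ioc 0 p, max (Q p - Q u) 0 := by
      refine setIntegral_eq_of_subset_of_forall_sdiff_eq_zero measurableSet_Ioo hsub ?_
      rintro u ⟨hu, hu'⟩
      have hpu : p ≤ u := by
        by_contra h
        exact hu' ⟨hu.1, (not_le.1 h).le⟩
      exact max_eq_right (sub_nonpos.2 (hmono hp hu hpu))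
    rw [hrest]
    refine setIntegral_congr_fun measurableSet_Ioc fun u hu => ?_
    exact max_eq_left (sub_nonneg.2 (hmono (hsub hu) hp hu.2))
  rw [intervalIntegral.integral_of_le hp.1.le]
  have hp0 : 0 < p := hp.1
  have hbound : ∀ η : ℝ, η - (1 / p) * ∫ ω, max (η - Z ω) 0 ∂μ
      ≤ (1 / p) * ∫ u in Set.Ioc 0 p, Q u := by
    intro η
    have h := mul_le_mul_of_nonneg_left (hle η) (one_div_pos.2 hp0).le
    have h2 : (1 / p) * (p * η - ∫ u in Set.Ioc 0 p, Q u)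
      = η - (1 / p) * ∫ u in Set.Ioc 0 p, Q u := by field_simp
    linarith
  apply le_antisymm
  · refine le_trans (le_of_eq ?_) (le_ciSup ⟨_, Set.forall_mem_range.2 hbound⟩ (Q p))
    simp only [heq]
    field_simp
    ring
  · exact ciSup_le hbound
end

section
/- Let K ⊆ ℝ^m be a closed, convex, pointed cone with dual cone K*, and let A, B ⊆ ℝ^m be nonempty compact sets such that A + K is closed and convex. Then A ⪯^ℓ_K B if and only if for every ℓ ∈ K* \ {0}, inf_{a∈A} ℓᵀa ≤ inf_{b∈B} ℓᵀb. -/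
open Set Pointwise

/-- The Euclidean inner product `ℓᵀa` on `ℝ^m`. -/
def dot {m : ℕ} (ℓ a : Fin m → ℝ) : ℝ := ∑ i, ℓ i * a i

/-- The dual cone `K* = {ℓ : ℓᵀy ≥ 0 for all y ∈ K}`. -/
def dualCone {m : ℕ} (K : Set (Fin m → ℝ)) : Set (Fin m → ℝ) :=
  {ℓ | ∀ y ∈ K, 0 ≤ dot ℓ y}

/-- `K` is a cone: closed under multiplication by non-negative scalars. -/
def IsConeSet {m : ℕ} (K : Set (Fin m → ℝ)) : Prop :=
  ∀ c : ℝ, 0 ≤ c → ∀ x ∈ K, c • x ∈ K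

/-- `K` is pointed: `K ∩ (−K) = {0}`. -/
def IsPointed {m : ℕ} (K : Set (Fin m → ℝ)) : Prop := K ∩ (-K) = {0}

theorem dot_add_aux {m : ℕ} (l a b : Fin m → ℝ) : dot l (a + b) = dot l a + dot l b := by
  simp [dot, mul_add, Finset.sum_add_distrib]

theorem bdd_aux {m : ℕ} (l : Fin m → ℝ) {A : Set (Fin m → ℝ)} (hA : IsCompact A) :
    BddBelow (dot l '' A) := by
  have hc : Continuous (dot l) := by
    unfold dot
    fun_prop
  exact (hA.image hc).bddBelow

theorem rep_aux {m : ℕ} (f : (Fin m → ℝ) →L[ℝ] ℝ) :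
    ∃ l : Fin m → ℝ, ∀ x, f x = dot l x := by
  refine ⟨fun i => f (Pi.single i 1), fun x => ?_⟩
  conv_lhs => rw [pi_eq_sum_univ' x]
  simp only [map_sum, map_smul, dot, smul_eq_mul]
  refine Finset.sum_congr rfl fun i _ => ?_
  rw [mul_comm]

/-- Vectorization of the lower set-less relation: for a closed, convex, pointed cone `K` and
nonempty compact sets `A, B` with `A + K` closed and convex,
`A ⪯^ℓ_K B ↔ ∀ ℓ ∈ K* \ {0}, inf_{a∈A} ℓᵀa ≤ inf_{b∈B} ℓᵀb`. -/
theorem lowerSetLess_iff_inf {m : ℕ} (K A B : Set (Fin m → ℝ))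
    (hKclosed : IsClosed K) (hKconvex : Convex ℝ K) (hKcone : IsConeSet K)
    (hKpointed : IsPointed K)
    (hA : A.Nonempty) (hAcomp : IsCompact A) (hB : B.Nonempty) (hBcomp : IsCompact B)
    (hAK : IsClosed (A + K)) (hAKconv : Convex ℝ (A + K)) :
    lowerSetLess K A B ↔
      ∀ ℓ ∈ dualCone K \ {0}, sInf (dot ℓ '' A) ≤ sInf (dot ℓ '' B) := by
  have h0 : (0 : Fin m → ℝ) ∈ K := by
    have h : (0 : Fin m → ℝ) ∈ K ∩ (-K) := by
      rw [hKpointed]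
      rfl
    exact h.1
  constructor
  · intro h l hl
    refine le_csInf (hB.image _) ?_
    rintro _ ⟨b, hb, rfl⟩
    obtain ⟨a, ha, hab⟩ := h b hb
    have h1 : sInf (dot l '' A) ≤ dot l a := csInf_le (bdd_aux l hAcomp) ⟨a, ha, rfl⟩
    have h2 : 0 ≤ dot l (b - a) := hl.1 _ hab
    have h3 := dot_add_aux l a (b - a)
    rw [add_sub_cancel] at h3
    linarith
  · intro h b hb
    by_contra hcon
    have hbn : b ∉ A + K := by
      rintro ⟨a, ha, k, hk, rfl⟩
      refine hcon ⟨a, ha, ?_⟩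
      simpa [leK] using hk
    obtain ⟨f, u, hfb, hfu⟩ := geometric_hahn_banach_point_closed hAKconv hAK hbn
    obtain ⟨l, hl⟩ := rep_aux f
    have hAu : ∀ a ∈ A, u < dot l a := by
      intro a ha
      rw [← hl]
      exact hfu a ⟨a, ha, 0, h0, add_zero a⟩
    obtain ⟨a0, ha0⟩ := hA
    have hdual : l ∈ dualCone K := by
      intro y hy
      by_contra hneg
      rw [not_le] at hneg
      have ha0u := hAu a0 ha0
      have hc : 0 ≤ (dot l a0 - u) / (- dot l y) :=
        div_nonneg (by linarith) (by linarith)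
      have h1 := hfu _ ⟨a0, ha0, _, hKcone _ hc y hy, rfl⟩
      change u < f (a0 + ((dot l a0 - u) / (- dot l y)) • y) at h1
      rw [map_add, map_smul, smul_eq_mul, hl, hl] at h1
      have h2 : (dot l a0 - u) / (- dot l y) * dot l y = - (dot l a0 - u) := by
        have hn : dot l y ≠ 0 := hneg.ne
        field_simp
      linarith
    have hne : l ≠ 0 := by
      rintro rfl
      have h1 := hAu a0 ha0
      rw [hl] at hfb
      simp only [dot, Pi.zero_apply, zero_mul, Finset.sum_const_zero] at h1 hfb
      linarith
    have h1 := h l ⟨hdual, hne⟩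
    have h2 : sInf (dot l '' B) ≤ dot l b := csInf_le (bdd_aux l hBcomp) ⟨b, hb, rfl⟩
    have h3 : u ≤ sInf (dot l '' A) := by
      refine le_csInf ⟨_, a0, ha0, rfl⟩ ?_
      rintro _ ⟨a, ha, rfl⟩
      exact (hAu a ha).le
    rw [hl] at hfb
    linarith
end

section
/- Let K ⊆ ℝ^m be a closed, convex, pointed cone with dual cone K*, and let A, B ⊆ ℝ^m be nonempty compact sets such that B − K is closed and convex. Then A ⪯^u_K B if and only if for every ℓ ∈ K* \ {0}, sup_{a∈A} ℓᵀa ≤ sup_{b∈B} ℓᵀb. -/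
open Set Pointwise

/-- Vectorization of the upper set-less relation: for a closed, convex, pointed cone `K` and
nonempty compact sets `A, B` with `B − K` closed and convex,
`A ⪯^u_K B ↔ ∀ ℓ ∈ K* \ {0}, sup_{a∈A} ℓᵀa ≤ sup_{b∈B} ℓᵀb`. -/
theorem upperSetLess_iff_sup {m : ℕ} (K A B : Set (Fin m → ℝ))
    (hKclosed : IsClosed K) (hKconvex : Convex ℝ K) (hKcone : IsConeSet K)
    (hKpointed : IsPointed K)
    (hA : A.Nonempty) (hAcomp : IsCompact A) (hB : B.Nonempty) (hBcomp : IsCompact B)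
    (hBK : IsClosed (B - K)) (hBKconv : Convex ℝ (B - K)) :
    upperSetLess K A B ↔
      ∀ ℓ ∈ dualCone K \ {0}, sSup (dot ℓ '' A) ≤ sSup (dot ℓ '' B) := by
  classical
  have hcont : ∀ ℓ : Fin m → ℝ, Continuous (dot ℓ) := by
    intro ℓ
    unfold dot
    fun_prop
  have hbdd : ∀ (ℓ : Fin m → ℝ) (S : Set (Fin m → ℝ)), IsCompact S → BddAbove (dot ℓ '' S) :=
    fun ℓ S hS => (hS.image (hcont ℓ)).bddAbove
  have hsub : ∀ ℓ x y : Fin m → ℝ, dot ℓ (x - y) = dot ℓ x - dot ℓ y := by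
    intro ℓ x y
    simp [dot, mul_sub, Finset.sum_sub_distrib]
  have h0 : (0 : Fin m → ℝ) ∈ K := by
    have h : (0 : Fin m → ℝ) ∈ K ∩ (-K) := by
      rw [hKpointed]
      exact mem_singleton _
    exact h.1
  constructor
  · rintro h ℓ ⟨hℓ, -⟩
    apply csSup_le (hA.image _)
    rintro _ ⟨a, ha, rfl⟩
    obtain ⟨b, hb, hab⟩ := h a ha
    have h1 := hℓ _ hab
    rw [hsub] at h1
    have h2 := le_csSup (hbdd ℓ B hBcomp) (mem_image_of_mem (dot ℓ) hb)
    linarith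
  · intro h a ha
    by_contra hcon
    have haBK : a ∉ B - K := by
      rintro ⟨b, hb, k, hk, hbk⟩
      apply hcon
      refine ⟨b, hb, ?_⟩
      have : b - a = k := by
        rw [← hbk]
        simp
      unfold leK
      rw [this]
      exact hk
    obtain ⟨f, u, hf, hu⟩ := geometric_hahn_banach_closed_point hBKconv hBK haBK
    let ℓ : Fin m → ℝ := fun i => f (Pi.single i 1)
    have hfl : ∀ x, dot ℓ x = f x := by
      intro x
      have := LinearMap.pi_apply_eq_sum_univ (f : (Fin m → ℝ) →ₗ[ℝ] ℝ) x
      simp only [ContinuousLinearMap.coe_coe, smul_eq_mul] at this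
      rw [this]
      unfold dot
      refine Finset.sum_congr rfl fun i _ => ?_
      rw [mul_comm]
      have hs : (Pi.single i 1 : Fin m → ℝ) = fun j => if i = j then 1 else 0 := by
        ext j
        simp [Pi.single_apply, eq_comm]
      change x i * f (Pi.single i 1) = _
      rw [hs]
    have hfB : ∀ b ∈ B, f b < u := by
      intro b hb
      have := hf (b - 0) (sub_mem_sub hb h0)
      rwa [sub_zero] at this
    obtain ⟨b₀, hb₀⟩ := hB
    have hdual : ℓ ∈ dualCone K := by
      intro y hy
      rw [hfl]
      by_contra hneg
      push Not at hneg
      have hc : 0 ≤ (u - f b₀) / (-f y) :=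
        div_nonneg (by linarith [hfB b₀ hb₀]) (by linarith)
      have h3 := hf _ (sub_mem_sub hb₀ (hKcone _ hc y hy))
      rw [map_sub, map_smul, smul_eq_mul] at h3
      have h4 : (u - f b₀) / (-f y) * f y = -(u - f b₀) := by
        have hy0 : f y ≠ 0 := hneg.ne
        field_simp
      linarith
    have hne : ℓ ≠ 0 := by
      intro hz
      have h5 := hfl a
      have h6 := hfl b₀
      rw [hz] at h5 h6
      simp [dot] at h5 h6
      linarith [hfB b₀ hb₀]
    have h7 := h ℓ ⟨hdual, hne⟩
    have h8 := le_csSup (hbdd ℓ A hAcomp) (mem_image_of_mem (dot ℓ) ha)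
    have h9 : sSup (dot ℓ '' B) ≤ u := by
      apply csSup_le (Nonempty.image _ ⟨b₀, hb₀⟩)
      rintro _ ⟨b, hb, rfl⟩
      rw [hfl]
      exact (hfB b hb).le
    rw [hfl] at h8
    linarith
end

section
/- Let K ⊆ ℝ^m be a closed, convex, pointed cone with dual cone K*, and let A, B ⊆ ℝ^m be nonempty compact sets such that A + K and B − K are closed and convex. Then A ⪯_K B if and only if for every ℓ ∈ K* \ {0}, both inf_{a∈A} ℓᵀa ≤ inf_{b∈B} ℓᵀb and sup_{a∈A} ℓᵀa ≤ sup_{b∈B} ℓᵀb. -/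
open Set Pointwise

theorem dot_sep_aux {m : ℕ} (K A : Set (Fin m → ℝ)) (hKcone : IsConeSet K)
    (h0 : (0 : Fin m → ℝ) ∈ K) (hA : A.Nonempty)
    (hAK : IsClosed (A + K)) (hAKconv : Convex ℝ (A + K)) (b : Fin m → ℝ) (hb : b ∉ A + K) :
    ∃ ℓ ∈ dualCone K \ {0}, ∃ u, dot ℓ b < u ∧ ∀ a ∈ A, u ≤ dot ℓ a := by
  obtain ⟨f, u, hfb, hf⟩ := geometric_hahn_banach_point_closed hAKconv hAK hb
  obtain ⟨a₀, ha₀⟩ := hA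
  have hdot : ∀ x, dot (fun i => f (Pi.single i 1)) x = f x := by
    intro x
    have := f.toLinearMap.pi_apply_eq_sum_univ x
    simp only [ContinuousLinearMap.coe_coe, smul_eq_mul] at this
    rw [this, dot]
    refine Finset.sum_congr rfl fun i _ => ?_
    rw [mul_comm]
    congr 2
    ext j
    simp [Pi.single_apply, eq_comm]
  have hfA : ∀ a ∈ A, u < f a := fun a ha => by
    have := hf _ (Set.add_mem_add ha h0)
    simpa using this
  refine ⟨fun i => f (Pi.single i 1), ⟨?_, ?_⟩, u, by rw [hdot]; exact hfb, fun a ha => by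
    rw [hdot]; exact (hfA a ha).le⟩
  · intro y hy
    rw [hdot]
    by_contra! hneg
    have h1 := hfA a₀ ha₀
    have ht : 0 ≤ (f a₀ - u) / (-f y) := div_nonneg (by linarith) (by linarith)
    have h2 := hf _ (Set.add_mem_add ha₀ (hKcone _ ht y hy))
    rw [map_add, map_smul, smul_eq_mul] at h2
    have h3 : (f a₀ - u) / (-f y) * f y = -(f a₀ - u) := by
      have : f y ≠ 0 := hneg.ne
      field_simp
    linarith
  · intro h
    have h' : (fun i => f (Pi.single i 1)) = (0 : Fin m → ℝ) := h
    have e : ∀ x, f x = 0 := fun x => by rw [← hdot x, h']; simp [dot]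
    have h1 := hfA a₀ ha₀
    rw [e] at h1 hfb
    linarith

theorem dot_sub_aux {m : ℕ} (ℓ a b : Fin m → ℝ) : dot ℓ (a - b) = dot ℓ a - dot ℓ b := by
  simp [dot, mul_sub, Finset.sum_sub_distrib]

theorem dot_neg_aux {m : ℕ} (ℓ a : Fin m → ℝ) : dot ℓ (-a) = - dot ℓ a := by
  simp [dot]

theorem dot_compact_aux {m : ℕ} (ℓ : Fin m → ℝ) {A : Set (Fin m → ℝ)} (hA : IsCompact A) :
    IsCompact (dot ℓ '' A) := by
  apply hA.image
  unfold dot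
  fun_prop

/-- Vectorization of the set-less relation: for a closed, convex, pointed cone `K` and nonempty
compact sets `A, B` with `A + K` and `B − K` closed and convex, `A ⪯_K B` iff for every
`ℓ ∈ K* \ {0}` both `inf_{a∈A} ℓᵀa ≤ inf_{b∈B} ℓᵀb` and `sup_{a∈A} ℓᵀa ≤ sup_{b∈B} ℓᵀb`. -/
theorem setLess_iff_inf_sup {m : ℕ} (K A B : Set (Fin m → ℝ))
    (hKclosed : IsClosed K) (hKconvex : Convex ℝ K) (hKcone : IsConeSet K)
    (hKpointed : IsPointed K)
    (hA : A.Nonempty) (hAcomp : IsCompact A) (hB : B.Nonempty) (hBcomp : IsCompact B)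
    (hAK : IsClosed (A + K)) (hAKconv : Convex ℝ (A + K))
    (hBK : IsClosed (B - K)) (hBKconv : Convex ℝ (B - K)) :
    setLess K A B ↔
      ∀ ℓ ∈ dualCone K \ {0},
        sInf (dot ℓ '' A) ≤ sInf (dot ℓ '' B) ∧ sSup (dot ℓ '' A) ≤ sSup (dot ℓ '' B) := by
  have h0 : (0 : Fin m → ℝ) ∈ K := by
    have : (0 : Fin m → ℝ) ∈ K ∩ (-K) := by rw [hKpointed]; rfl
    exact this.1
  constructor
  · rintro ⟨hl, hu⟩ ℓ ⟨hℓ, -⟩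
    constructor
    · refine le_csInf (hB.image _) ?_
      rintro _ ⟨b, hb, rfl⟩
      obtain ⟨a, ha, hab⟩ := hl b hb
      have h1 := hℓ _ hab
      rw [dot_sub_aux] at h1
      exact (csInf_le (dot_compact_aux ℓ hAcomp).bddBelow (mem_image_of_mem _ ha)).trans
        (by linarith)
    · refine csSup_le (hA.image _) ?_
      rintro _ ⟨a, ha, rfl⟩
      obtain ⟨b, hb, hab⟩ := hu a ha
      have h1 := hℓ _ hab
      rw [dot_sub_aux] at h1
      exact le_trans (by linarith)
        (le_csSup (dot_compact_aux ℓ hBcomp).bddAbove (mem_image_of_mem _ hb))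
  · intro h
    constructor
    · intro b hb
      by_contra hcon
      have hbn : b ∉ A + K := by
        rintro ⟨a, ha, k, hk, rfl⟩
        exact hcon ⟨a, ha, by simpa [leK] using hk⟩
      obtain ⟨ℓ, hℓ, u, hu, hA'⟩ := dot_sep_aux K A hKcone h0 hA hAK hAKconv b hbn
      have h1 := (h ℓ hℓ).1
      have h2 := csInf_le (dot_compact_aux ℓ hBcomp).bddBelow (mem_image_of_mem (dot ℓ) hb)
      have h3 : u ≤ sInf (dot ℓ '' A) := le_csInf (hA.image _) (by
        rintro _ ⟨a, ha, rfl⟩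
        exact hA' a ha)
      linarith
    · intro a ha
      by_contra hcon
      have heq : -B + K = -(B - K) := by
        rw [sub_eq_add_neg, neg_add, neg_neg]
      have han : -a ∉ -B + K := by
        rintro ⟨b, hb, k, hk, hbk⟩
        refine hcon ⟨-b, hb, ?_⟩
        have : k = -b - a := by
          rw [sub_eq_add_neg, ← hbk]; simp
        rw [leK, ← this]
        exact hk
      obtain ⟨ℓ, hℓ, u, hu, hB'⟩ := dot_sep_aux K (-B) hKcone h0 hB.neg
        (by rw [heq]; exact hBK.neg) (by rw [heq]; exact hBKconv.neg) (-a) han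
      have h1 := (h ℓ hℓ).2
      rw [dot_neg_aux] at hu
      have h2 := le_csSup (dot_compact_aux ℓ hAcomp).bddAbove (mem_image_of_mem (dot ℓ) ha)
      have h3 : sSup (dot ℓ '' B) ≤ -u := csSup_le (hB.image _) (by
        rintro _ ⟨b, hb, rfl⟩
        have := hB' (-b) (by simpa using hb)
        rw [dot_neg_aux] at this
        linarith)
      linarith
end

section
/- Let Z be an integrable real-valued random variable whose cumulative distribution function F_Z is continuous, and let p ∈ (0,1). Then the superquantile equals the mean of the upper p-tail distribution of Z: S̄_p[Z] = (1/(1−p))·E[Z · 1_{Z ≥ Q_Z(p)}], i.e., S̄_p[Z] = E[Z | Z ≥ Q_Z(p)]. -/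
open MeasureTheory

open ProbabilityTheory Set Filter Topology in
theorem sq_aux (ν : Measure ℝ) [IsProbabilityMeasure ν] (hc : Continuous (cdf ν))
    (Q : ℝ → ℝ) (hQ : ∀ u, Q u = sInf {t : ℝ | u ≤ cdf ν t}) (p : ℝ) (hp : p ∈ Set.Ioo (0 : ℝ) 1) :
    ∫ u in p..(1 : ℝ), Q u = ∫ x in Ici (Q p), x ∂ν := by
  have hmono := monotone_cdf ν
  have hne : ∀ u ∈ Ioo (0:ℝ) 1, {t : ℝ | u ≤ cdf ν t}.Nonempty := fun u hu => by
    obtain ⟨t, ht⟩ := ((tendsto_cdf_atTop ν).eventually (lt_mem_nhds hu.2)).exists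
    exact ⟨t, ht.le⟩
  have hbd : ∀ u ∈ Ioo (0:ℝ) 1, BddBelow {t : ℝ | u ≤ cdf ν t} := fun u hu => by
    obtain ⟨t, ht⟩ := ((tendsto_cdf_atBot ν).eventually (gt_mem_nhds hu.1)).exists
    refine ⟨t, fun s hs => ?_⟩
    by_contra! h
    have h1 := hmono h.le
    have h2 : u ≤ cdf ν s := hs
    linarith
  have hcl : ∀ u, IsClosed {t : ℝ | u ≤ cdf ν t} := fun u => isClosed_le continuous_const hc
  have gal : ∀ u ∈ Ioo (0:ℝ) 1, ∀ t, Q u ≤ t ↔ u ≤ cdf ν t := fun u hu t => by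
    constructor
    · intro h
      have h1 : u ≤ cdf ν (Q u) := by
        rw [hQ u]; exact (hcl u).csInf_mem (hne u hu) (hbd u hu)
      exact h1.trans (hmono h)
    · intro h
      rw [hQ u]
      exact csInf_le (hbd u hu) h
  have hFQ : ∀ u ∈ Ioo (0:ℝ) 1, cdf ν (Q u) = u := fun u hu => by
    apply le_antisymm
    · have ht : Tendsto (cdf ν) (𝓝[<] (Q u)) (𝓝 (cdf ν (Q u))) := hc.continuousWithinAt
      refine le_of_tendsto ht ?_
      filter_upwards [self_mem_nhdsWithin] with t ht
      by_contra! h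
      exact absurd ((gal u hu t).2 h.le) (not_le.2 ht)
    · exact (gal u hu _).1 le_rfl
  have hle : ∀ u ∈ Ioo (0:ℝ) 1, ∀ v ∈ Ioo (0:ℝ) 1, (Q u ≤ Q v ↔ u ≤ v) := fun u hu v hv => by
    rw [gal u hu, hFQ v hv]
  have hm : AEMeasurable Q (volume.restrict (Ioo (0:ℝ) 1)) :=
    aemeasurable_restrict_of_monotoneOn measurableSet_Ioo
      (fun u hu v hv h => (hle u hu v hv).2 h)
  have hmap : Measure.map Q (volume.restrict (Ioo (0:ℝ) 1)) = ν := by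
    have : IsFiniteMeasure (volume.restrict (Ioo (0:ℝ) 1)) := ⟨by simp⟩
    refine Measure.ext_of_Iic _ _ fun t => ?_
    rw [Measure.map_apply_of_aemeasurable hm measurableSet_Iic, ← ofReal_cdf ν t,
      Measure.restrict_apply' measurableSet_Ioo]
    have h1 : Q ⁻¹' Iic t ∩ Ioo 0 1 = Iic (cdf ν t) ∩ Ioo 0 1 := by
      ext u
      simp only [mem_inter_iff, mem_preimage, mem_Iic]
      exact and_congr_left fun hu => gal u hu t
    rw [h1, ← Measure.restrict_apply measurableSet_Iic, restrict_Ioo_eq_restrict_Ioc,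
      Measure.restrict_apply measurableSet_Iic]
    have h2 : Iic (cdf ν t) ∩ Ioc 0 1 = Ioc 0 (cdf ν t) := by
      ext u
      have := cdf_le_one ν t
      simp only [mem_inter_iff, mem_Iic, mem_Ioc]
      constructor
      · rintro ⟨a, b, c⟩; exact ⟨b, a⟩
      · rintro ⟨a, b⟩; exact ⟨b, a, b.trans this⟩
    rw [h2, Real.volume_Ioc, sub_zero]
  rw [intervalIntegral.integral_of_le hp.2.le, ← restrict_Ioo_eq_restrict_Ioc,
    Measure.restrict_congr_set (Ioo_ae_eq_Ico (μ := volume) (a := p) (b := 1))]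
  conv_rhs => rw [← hmap]
  rw [setIntegral_map measurableSet_Ici (by fun_prop) hm,
    Measure.restrict_restrict₀' measurableSet_Ioo.nullMeasurableSet]
  have h3 : Q ⁻¹' Ici (Q p) ∩ Ioo 0 1 = Ico p 1 := by
    ext u
    simp only [mem_inter_iff, mem_preimage, mem_Ici]
    constructor
    · rintro ⟨a, b⟩; exact ⟨(hle p hp u b).1 a, b.2⟩
    · rintro ⟨a, b⟩
      have hu : u ∈ Ioo (0:ℝ) 1 := ⟨hp.1.trans_le a, b⟩
      exact ⟨(hle p hp u hu).2 a, hu⟩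
  rw [h3]

/-- When the CDF of `Z` is continuous, the superquantile equals the mean of the upper `p`-tail:
`S̄_p[Z] = (1/(1−p))·E[Z · 1_{Z ≥ Q_Z(p)}] = E[Z | Z ≥ Q_Z(p)]`. -/
theorem superquantile_eq_tail_mean {Ω : Type*} [MeasurableSpace Ω] (μ : Measure Ω)
    [IsProbabilityMeasure μ] (Z : Ω → ℝ) (hZ : Measurable Z) (hZint : Integrable Z μ)
    (hFcont : Continuous (cdfRV μ Z))
    (p : ℝ) (hp : p ∈ Set.Ioo (0 : ℝ) 1) :
    (1 / (1 - p)) * ∫ u in p..(1 : ℝ), quantileRV μ Z u =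
      (1 / (1 - p)) * ∫ ω in {ω | quantileRV μ Z p ≤ Z ω}, Z ω ∂μ := by
  have hP : IsProbabilityMeasure (μ.map Z) := Measure.isProbabilityMeasure_map hZ.aemeasurable
  have hcdf : ∀ t, cdfRV μ Z t = ProbabilityTheory.cdf (μ.map Z) t := fun t => by
    rw [ProbabilityTheory.cdf_eq_real, Measure.real, Measure.map_apply hZ measurableSet_Iic]
    rfl
  have hc : Continuous (ProbabilityTheory.cdf (μ.map Z)) := by
    have h : cdfRV μ Z = ProbabilityTheory.cdf (μ.map Z) := funext hcdf
    rw [← h]; exact hFcont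
  rw [sq_aux (μ.map Z) hc (quantileRV μ Z) (fun u => by simp only [quantileRV, hcdf]) p hp,
    setIntegral_map measurableSet_Ici (by fun_prop) hZ.aemeasurable]
  rfl
end

section
/- Let Z be an integrable real-valued random variable whose cumulative distribution function F_Z is continuous, and let p ∈ (0,1). Then the subquantile equals the mean of the lower p-tail distribution of Z: S̲_p[Z] = (1/p)·E[Z · 1_{Z ≤ Q_Z(p)}], i.e., S̲_p[Z] = E[Z | Z ≤ Q_Z(p)]. -/
open MeasureTheory

theorem aux_mono {Ω : Type*} [MeasurableSpace Ω] (μ : Measure Ω)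
    [IsProbabilityMeasure μ] (Z : Ω → ℝ) : Monotone (cdfRV μ Z) := by
  intro a b hab
  exact ENNReal.toReal_mono (measure_ne_top _ _)
    (measure_mono (fun ω (h : Z ω ≤ a) => h.trans hab))

theorem aux_cdf {Ω : Type*} [MeasurableSpace Ω] (μ : Measure Ω)
    [IsProbabilityMeasure μ] (Z : Ω → ℝ) (hZ : Measurable Z) :
    cdfRV μ Z = fun t => ProbabilityTheory.cdf (μ.map Z) t := by
  have := Measure.isProbabilityMeasure_map (μ := μ) hZ.aemeasurable
  funext t
  rw [ProbabilityTheory.cdf_eq_real, Measure.real, Measure.map_apply hZ measurableSet_Iic]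
  rfl

theorem aux_galois {Ω : Type*} [MeasurableSpace Ω] (μ : Measure Ω)
    [IsProbabilityMeasure μ] (Z : Ω → ℝ) (hZ : Measurable Z)
    (hFcont : Continuous (cdfRV μ Z)) (u : ℝ) (hu : u ∈ Set.Ioo (0 : ℝ) 1) (t : ℝ) :
    quantileRV μ Z u ≤ t ↔ u ≤ cdfRV μ Z t := by
  have hbot : Filter.Tendsto (cdfRV μ Z) Filter.atBot (nhds 0) := by
    rw [aux_cdf μ Z hZ]; exact ProbabilityTheory.tendsto_cdf_atBot _
  have htop : Filter.Tendsto (cdfRV μ Z) Filter.atTop (nhds 1) := by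
    rw [aux_cdf μ Z hZ]; exact ProbabilityTheory.tendsto_cdf_atTop _
  have hne : {t : ℝ | u ≤ cdfRV μ Z t}.Nonempty := by
    obtain ⟨x, hx⟩ := (htop.eventually (lt_mem_nhds hu.2)).exists
    exact ⟨x, hx.le⟩
  have hbdd : BddBelow {t : ℝ | u ≤ cdfRV μ Z t} := by
    obtain ⟨x, hx⟩ := (hbot.eventually (gt_mem_nhds hu.1)).exists
    refine ⟨x, fun y (hy : u ≤ _) => ?_⟩
    by_contra! h
    exact absurd (aux_mono μ Z h.le) (by linarith)
  have hcl : IsClosed {t : ℝ | u ≤ cdfRV μ Z t} := isClosed_le continuous_const hFcont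
  constructor
  · intro h
    exact le_trans (hcl.csInf_mem hne hbdd) (aux_mono μ Z h)
  · intro h
    exact csInf_le hbdd h

theorem aux_at {Ω : Type*} [MeasurableSpace Ω] (μ : Measure Ω)
    [IsProbabilityMeasure μ] (Z : Ω → ℝ) (hZ : Measurable Z)
    (hFcont : Continuous (cdfRV μ Z)) (u : ℝ) (hu : u ∈ Set.Ioo (0 : ℝ) 1) :
    cdfRV μ Z (quantileRV μ Z u) = u := by
  have hbot : Filter.Tendsto (cdfRV μ Z) Filter.atBot (nhds 0) := by
    rw [aux_cdf μ Z hZ]; exact ProbabilityTheory.tendsto_cdf_atBot _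
  have htop : Filter.Tendsto (cdfRV μ Z) Filter.atTop (nhds 1) := by
    rw [aux_cdf μ Z hZ]; exact ProbabilityTheory.tendsto_cdf_atTop _
  obtain ⟨x, hx⟩ := (htop.eventually (lt_mem_nhds hu.2)).exists
  obtain ⟨y, hy⟩ := (hbot.eventually (gt_mem_nhds hu.1)).exists
  obtain ⟨t, ht⟩ := mem_range_of_exists_le_of_exists_ge hFcont ⟨y, hy.le⟩ ⟨x, hx.le⟩
  apply le_antisymm
  · calc _ ≤ cdfRV μ Z t := aux_mono μ Z ((aux_galois μ Z hZ hFcont u hu t).2 ht.ge)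
      _ = u := ht
  · exact (aux_galois μ Z hZ hFcont u hu _).1 le_rfl

theorem aux_map {Ω : Type*} [MeasurableSpace Ω] (μ : Measure Ω)
    [IsProbabilityMeasure μ] (Z : Ω → ℝ) (hZ : Measurable Z)
    (hFcont : Continuous (cdfRV μ Z)) (p : ℝ) (hp : p ∈ Set.Ioo (0 : ℝ) 1)
    (hQ : AEMeasurable (quantileRV μ Z) (volume.restrict (Set.Ioc 0 p))) :
    (volume.restrict (Set.Ioc 0 p)).map (quantileRV μ Z) =
      (μ.restrict {ω | Z ω ≤ quantileRV μ Z p}).map Z := by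
  refine Measure.ext_of_Iic _ _ fun t => ?_
  rw [Measure.map_apply_of_aemeasurable hQ measurableSet_Iic,
    Measure.map_apply hZ measurableSet_Iic, Measure.restrict_apply (hZ measurableSet_Iic),
    Measure.restrict_apply' measurableSet_Ioc]
  have h1 : quantileRV μ Z ⁻¹' Set.Iic t ∩ Set.Ioc 0 p = Set.Ioc 0 (min (cdfRV μ Z t) p) := by
    ext u
    simp only [Set.mem_inter_iff, Set.mem_preimage, Set.mem_Iic, Set.mem_Ioc, le_min_iff]
    constructor
    · rintro ⟨h, h0, h1⟩
      exact ⟨h0, (aux_galois μ Z hZ hFcont u ⟨h0, h1.trans_lt hp.2⟩ t).1 h, h1⟩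
    · rintro ⟨h0, h, h1⟩
      exact ⟨(aux_galois μ Z hZ hFcont u ⟨h0, h1.trans_lt hp.2⟩ t).2 h, h0, h1⟩
  have h2 : Z ⁻¹' Set.Iic t ∩ {ω | Z ω ≤ quantileRV μ Z p} =
      {ω | Z ω ≤ min t (quantileRV μ Z p)} := by
    ext ω
    simp
  have h3 : min (cdfRV μ Z t) p = cdfRV μ Z (min t (quantileRV μ Z p)) := by
    rw [(aux_mono μ Z).map_min, aux_at μ Z hZ hFcont p hp]
  rw [h1, h2, h3, Real.volume_Ioc, sub_zero, cdfRV, ENNReal.ofReal_toReal (measure_ne_top _ _)]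

/-- When the CDF of `Z` is continuous, the subquantile equals the mean of the lower `p`-tail:
`S̲_p[Z] = (1/p)·E[Z · 1_{Z ≤ Q_Z(p)}] = E[Z | Z ≤ Q_Z(p)]`. -/
theorem subquantile_eq_tail_mean {Ω : Type*} [MeasurableSpace Ω] (μ : Measure Ω)
    [IsProbabilityMeasure μ] (Z : Ω → ℝ) (hZ : Measurable Z) (hZint : Integrable Z μ)
    (hFcont : Continuous (cdfRV μ Z))
    (p : ℝ) (hp : p ∈ Set.Ioo (0 : ℝ) 1) :
    (1 / p) * ∫ u in (0 : ℝ)..p, quantileRV μ Z u =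
      (1 / p) * ∫ ω in {ω | Z ω ≤ quantileRV μ Z p}, Z ω ∂μ := by
  have hQ : AEMeasurable (quantileRV μ Z) (volume.restrict (Set.Ioc 0 p)) := by
    refine aemeasurable_restrict_of_monotoneOn measurableSet_Ioc ?_
    intro a ha b hb hab
    rw [aux_galois μ Z hZ hFcont a ⟨ha.1, ha.2.trans_lt hp.2⟩,
      aux_at μ Z hZ hFcont b ⟨hb.1, hb.2.trans_lt hp.2⟩]
    exact hab
  congr 1
  rw [intervalIntegral.integral_of_le hp.1.le]
  have e1 := integral_map hQ (f := fun x : ℝ => x) measurable_id.aestronglyMeasurable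
  have e2 := integral_map (μ := μ.restrict {ω | Z ω ≤ quantileRV μ Z p}) hZ.aemeasurable
    (f := fun x : ℝ => x) measurable_id.aestronglyMeasurable
  rw [← e1, ← e2, aux_map μ Z hZ hFcont p hp hQ]
end
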